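/- arXiv:math/0408309 — 2 statements merged into one kernel-verified Lean document; each statement's English description precedes it below -/
import Mathlib

section
/- Let q be rational with 0 ≤ q < 1 and let LNS(q) = (y_0, …, y_L) with y_0 = −∞ and y_L = q, where y_l = a_l/b_l is in lowest terms with b_l ≥ 0. Then for every l = 1, …, L one has a_{l−1} b_l − a_l b_{l−1} = −1 (equivalently det [[b_l, −a_l], [b_{l−1}, −a_{l−1}]] = 1), and the denominators satisfy 0 = b_0 < b_1 < … < b_{L−1} < b_L; that is, the reversed sequence (y_L, …, y_0) is a minimal partition of q. -/
noncomputable section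

open Complex MeasureTheory

/- ## Farey machinery -/

/-- The Farey sequence of level `n`, as a subset of the extended reals;
`⊥ = -∞ = -1/0`, `⊤ = ∞ = 1/0`. -/
def fareySet (n : ℕ) : Set EReal :=
  {⊥, ⊤, 0} ∪ {x : EReal | ∃ q : ℚ, x = ((q : ℝ) : EReal) ∧ q.num.natAbs ≤ n ∧ q.den ≤ n}

/-- The level of an element of `ℚ ∪ {±∞}`. -/
def flev (x : EReal) : ℕ := sInf {n : ℕ | x ∈ fareySet n}

/-- The left neighbor map: the largest element of `F_{lev x}` strictly below `x`. -/
def fLN (x : EReal) : EReal := sSup {r : EReal | r ∈ fareySet (flev x) ∧ r < x}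

/-- The length `L` of the left neighbor sequence: the least `L` with `LN^L q = -∞`. -/
def fL (x : EReal) : ℕ := sInf {L : ℕ | fLN^[L] x = ⊥}

/-- The members `y_l = LN^{L-l}(q)` of the left neighbor sequence `LNS(q)`. -/
def yseq (q : ℚ) (l : ℕ) : EReal := fLN^[fL ((q : ℝ) : EReal) - l] ((q : ℝ) : EReal)

/-- The fraction `a/c` as an element of `ℚ ∪ {±∞}` (with `1/0 = ∞`, `-1/0 = -∞`). -/
def efrac (a c : ℤ) : EReal :=
  if c = 0 then (if 0 < a then ⊤ else ⊥) else ((((a : ℚ) / (c : ℚ) : ℚ) : ℝ) : EReal)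

open Classical in
/-- The numerator of an element of `ℚ ∪ {±∞}` in lowest terms (`-∞ = -1/0`, `∞ = 1/0`). -/
def enum (x : EReal) : ℤ :=
  if x = ⊥ then -1
  else if x = ⊤ then 1
  else if h : ∃ q : ℚ, x = ((q : ℝ) : EReal) then h.choose.num else 0

open Classical in
/-- The (nonnegative) denominator of an element of `ℚ ∪ {±∞}` in lowest terms. -/
def eden (x : EReal) : ℤ :=
  if x = ⊥ then 0
  else if x = ⊤ then 0
  else if h : ∃ q : ℚ, x = ((q : ℝ) : EReal) then (h.choose.den : ℤ) else 0

/-- The matrix `m_l = [[b_l, -a_l], [b_{l-1}, -a_{l-1}]]` from `M(q) = Σ_l m_l`. -/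
def mMat (q : ℚ) (l : ℕ) : Matrix (Fin 2) (Fin 2) ℤ :=
  !![eden (yseq q l), -enum (yseq q l); eden (yseq q (l - 1)), -enum (yseq q (l - 1))]

/- ## Matrix groups -/

abbrev SL2 := Matrix.SpecialLinearGroup (Fin 2) ℤ

/-- The Hecke congruence subgroup `Γ₀(n)` inside `SL₂(ℤ)`. -/
def Gam0 (n : ℕ) : Set SL2 := {g : SL2 | (n : ℤ) ∣ (g : Matrix (Fin 2) (Fin 2) ℤ) 1 0}

/-- `X_m`: upper triangular integer matrices `[[a,b],[0,d]]` with `ad = m`, `d > b ≥ 0`. -/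
def Xset (m : ℕ) : Set (Matrix (Fin 2) (Fin 2) ℤ) :=
  {A | A 1 0 = 0 ∧ A 0 0 * A 1 1 = (m : ℤ) ∧ 0 ≤ A 0 1 ∧ A 0 1 < A 1 1}

/-- `X_m` as a finite set. -/
def XF (m : ℕ) : Finset (Matrix (Fin 2) (Fin 2) ℤ) :=
  ((m.divisors ×ˢ Finset.range m).filter fun p => p.2 < p.1).image
    fun p => !![((m / p.1 : ℕ) : ℤ), (p.2 : ℤ); 0, (p.1 : ℤ)]

/-- Möbius action of an integer matrix on (a suitable part of) `ℂ`. -/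
def moeb (g : Matrix (Fin 2) (Fin 2) ℤ) (z : ℂ) : ℂ :=
  ((g 0 0 : ℂ) * z + (g 0 1 : ℂ)) / ((g 1 0 : ℂ) * z + (g 1 1 : ℂ))

/-- `α : Fin μ → SL₂(ℤ)` is a full set of representatives of the right cosets
`Γ₀(n) \ SL₂(ℤ)`. -/
def IsCosetReps (n : ℕ) {μ : ℕ} (α : Fin μ → SL2) : Prop :=
  (∀ g : SL2, ∃ j : Fin μ, ∃ γ ∈ Gam0 n, g = γ * α j) ∧
  (∀ j k : Fin μ, (∃ γ ∈ Gam0 n, α j = γ * α k) → j = k)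

open Classical in
/-- The representation of `SL₂(ℤ)` induced from the trivial representation of `Γ₀(n)`:
a permutation matrix realization of the right regular representation. -/
def rho (n : ℕ) {μ : ℕ} (α : Fin μ → SL2) (g : SL2) : Matrix (Fin μ) (Fin μ) ℂ :=
  fun i j => if α i * g * (α j)⁻¹ ∈ Gam0 n then 1 else 0

/- ## Analysis -/

/-- Partial derivative in the `x` (real) direction. -/
def pdx (f : ℂ → ℂ) (z : ℂ) : ℂ := deriv (fun x : ℝ => f (x + z.im * Complex.I)) z.re

/-- Partial derivative in the `y` (imaginary) direction. -/
def pdy (f : ℂ → ℂ) (z : ℂ) : ℂ := deriv (fun y : ℝ => f (z.re + y * Complex.I)) z.im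

/-- The hyperbolic Laplacian `Δ = -y²(∂_x² + ∂_y²)`. -/
def laplace (f : ℂ → ℂ) (z : ℂ) : ℂ := -(z.im : ℂ) ^ 2 * (pdx (pdx f) z + pdy (pdy f) z)

/-- `R_ζ(z) = Im z / |z - ζ|²`. -/
def Rfun (ζ : ℝ) (z : ℂ) : ℝ := z.im / ((z.re - ζ) ^ 2 + z.im ^ 2)

/-- `R_ζ^s(z)`, using the principal branch on the positive real `R_ζ(z)`. -/
def Rpow (s : ℂ) (ζ : ℝ) (z : ℂ) : ℂ := ((Rfun ζ z : ℝ) : ℂ) ^ s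

/-- A Maass cusp form for `Γ₀(n)` with spectral parameter `s`. -/
structure IsCuspForm (n : ℕ) (s : ℂ) (u : ℂ → ℂ) : Prop where
  analytic : AnalyticOnNhd ℝ u {z : ℂ | 0 < z.im}
  invar : ∀ g ∈ Gam0 n, ∀ z : ℂ, 0 < z.im → u (moeb g z) = u z
  eigen : ∀ z : ℂ, 0 < z.im → laplace u z = s * (1 - s) * u z
  decay : ∀ g : SL2, ∀ C : ℝ, ∃ K T : ℝ, ∀ z : ℂ, 0 < z.im → T ≤ z.im →
    ‖u (moeb g z)‖ ≤ K * z.im ^ C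

/-- A vector valued cusp form for `Γ₀(n)` with spectral parameter `s`. -/
structure IsVVCuspForm (n : ℕ) {μ : ℕ} (α : Fin μ → SL2) (s : ℂ) (U : ℂ → Fin μ → ℂ) :
    Prop where
  analytic : ∀ j, AnalyticOnNhd ℝ (fun z => U z j) {z : ℂ | 0 < z.im}
  equivar : ∀ g : SL2, ∀ z : ℂ, 0 < z.im → ∀ j,
    U (moeb g z) j = ∑ k, rho n α g j k * U z k
  eigen : ∀ j, ∀ z : ℂ, 0 < z.im → laplace (fun w => U w j) z = s * (1 - s) * U z j
  decay : ∀ j, ∀ C : ℝ, ∃ K T : ℝ, ∀ z : ℂ, 0 < z.im → T ≤ z.im → ‖U z j‖ ≤ K * z.im ^ C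

/-- The map `Π` from cusp forms to vector valued cusp forms. -/
def PiMap {μ : ℕ} (α : Fin μ → SL2) (u : ℂ → ℂ) : ℂ → Fin μ → ℂ :=
  fun z j => u (moeb (α j : Matrix (Fin 2) (Fin 2) ℤ) z)

/-- The integral transform `P`, componentwise:
`(Pu)(ζ) = ∫_0^∞ (u(iy) ∂_x R_ζ^s(iy) - R_ζ^s(iy) ∂_x u(iy)) dy`. -/
def Ptrans (s : ℂ) (v : ℂ → ℂ) (ζ : ℝ) : ℂ :=
  ∫ y in Set.Ioi (0 : ℝ),
    (v (y * Complex.I) * pdx (Rpow s ζ) (y * Complex.I)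
      - Rpow s ζ (y * Complex.I) * pdx v (y * Complex.I))

def Tmat : SL2 := ⟨!![1, 1; 0, 1], by norm_num [Matrix.det_fin_two_of]⟩

def Tmat' : SL2 := ⟨!![1, 0; 1, 1], by norm_num [Matrix.det_fin_two_of]⟩

/-- A (vector valued) period function for `Γ₀(n)` with spectral parameter `s`. -/
structure IsPeriodFn (n : ℕ) {μ : ℕ} (α : Fin μ → SL2) (s : ℂ) (ψ : ℝ → Fin μ → ℂ) :
    Prop where
  analytic : ∀ i, AnalyticOnNhd ℝ (fun ζ => ψ ζ i) (Set.Ioi 0)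
  threeterm : ∀ ζ : ℝ, 0 < ζ → ∀ i,
    ψ ζ i = ∑ k, rho n α Tmat⁻¹ i k * ψ (ζ + 1) k
      + ((ζ + 1 : ℝ) : ℂ) ^ (-(2 * s)) * ∑ k, rho n α Tmat'⁻¹ i k * ψ (ζ / (ζ + 1)) k
  grow0 : ∀ i, ∃ K ε : ℝ, 0 < ε ∧ ∀ ζ : ℝ, 0 < ζ → ζ < ε →
    ‖ψ ζ i‖ ≤ K * ζ ^ (max 0 (-2 * s.re))
  growInf : ∀ i, ∃ K T : ℝ, ∀ ζ : ℝ, T ≤ ζ → 0 < ζ →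
    ‖ψ ζ i‖ ≤ K * ζ ^ (min 0 (-2 * s.re))


theorem mem_fareySet_zero (n : ℕ) : (0 : EReal) ∈ fareySet n := by
  simp [fareySet]

theorem enum_coe (q : ℚ) : enum ((q : ℝ) : EReal) = q.num := by
  have h : ∃ p : ℚ, ((q : ℝ) : EReal) = ((p : ℝ) : EReal) := ⟨q, rfl⟩
  have hq : h.choose = q := by
    have := h.choose_spec
    exact_mod_cast this.symm
  rw [enum, if_neg (EReal.coe_ne_bot _), if_neg (EReal.coe_ne_top _), dif_pos h, hq]

theorem eden_coe (q : ℚ) : eden ((q : ℝ) : EReal) = q.den := by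
  have h : ∃ p : ℚ, ((q : ℝ) : EReal) = ((p : ℝ) : EReal) := ⟨q, rfl⟩
  have hq : h.choose = q := by
    have := h.choose_spec
    exact_mod_cast this.symm
  rw [eden, if_neg (EReal.coe_ne_bot _), if_neg (EReal.coe_ne_top _), dif_pos h, hq]

theorem enum_bot : enum ⊥ = -1 := if_pos rfl

theorem eden_bot : eden ⊥ = 0 := if_pos rfl

theorem flev_zero : flev 0 = 0 :=
  Nat.sInf_eq_zero.2 (Or.inl (mem_fareySet_zero 0))

theorem fLN_zero : fLN 0 = ⊥ := by
  rw [fLN, flev_zero, sSup_eq_bot]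
  rintro r ⟨hr, hlt⟩
  rcases hr with hr | ⟨p, -, -, hp⟩
  · rcases hr with rfl | rfl | rfl
    · rfl
    · simp at hlt
    · simp at hlt
  · exact absurd hp (by have := p.den_pos; omega)

theorem num_lt_den_of_lt_one {q : ℚ} (h1 : q < 1) : q.num < q.den := by
  simpa [Rat.lt_iff] using h1

theorem flev_coe {q : ℚ} (h0 : 0 < q) (h1 : q < 1) : flev ((q : ℝ) : EReal) = q.den := by
  have hnum : 0 < q.num := Rat.num_pos.2 h0
  have hlt := num_lt_den_of_lt_one h1
  have hmem : ∀ n, ((q : ℝ) : EReal) ∈ fareySet n ↔ q.den ≤ n := by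
    intro n
    constructor
    · rintro (hq | ⟨p, hp, -, hd⟩)
      · rcases hq with hq | hq | hq
        · exact absurd hq (EReal.coe_ne_bot _)
        · exact absurd hq (EReal.coe_ne_top _)
        · have : q = 0 := by exact_mod_cast Set.mem_singleton_iff.1 hq
          exact absurd this h0.ne'
      · have : q = p := by exact_mod_cast hp
        rwa [this]
    · intro h
      exact Or.inr ⟨q, rfl, by omega, h⟩
  refine le_antisymm (Nat.sInf_le ((hmem _).2 le_rfl)) ?_
  exact (hmem _).1 (Nat.sInf_mem (s := {n | ((q : ℝ) : EReal) ∈ fareySet n}) ⟨_, (hmem _).2 le_rfl⟩)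

/-- The left Farey parent of a rational number in the open unit interval. -/
theorem exists_left_parent {q : ℚ} (h0 : 0 < q) (h1 : q < 1) :
    ∃ p : ℚ, 0 ≤ p ∧ q.num * p.den - p.num * q.den = 1 ∧ p.den < q.den := by
  have hnum : 0 < q.num := Rat.num_pos.2 h0
  have hlt := num_lt_den_of_lt_one h1
  have hcop : IsCoprime q.num (q.den : ℤ) := Rat.isCoprime_num_den q
  obtain ⟨s, t, hst⟩ := hcop
  have hv : (0 : ℤ) < q.den := by omega
  set b := s % q.den with hb
  have hb0 : 0 ≤ b := Int.emod_nonneg _ hv.ne'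
  have hbv : b < q.den := Int.emod_lt_of_pos _ hv
  have hsb : b + q.den * (s / q.den) = s := Int.emod_add_mul_ediv s q.den
  set a := -t - q.num * (s / q.den) with ha
  have hab : q.num * b - a * q.den = 1 := by
    rw [ha]; linear_combination hst + q.num * hsb
  have hbpos : 0 < b := by
    rcases hb0.lt_or_eq with h | h
    · exact h
    · rw [← h] at hab
      have : (q.den : ℤ) ∣ 1 := ⟨-a, by linear_combination -hab⟩
      have := Int.le_of_dvd one_pos this
      omega
  have ha0 : 0 ≤ a := by
    by_contra! h
    nlinarith
  have hcop' : a.natAbs.Coprime b.natAbs :=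
    Int.isCoprime_iff_gcd_eq_one.1 ⟨-q.den, q.num, by linear_combination hab⟩
  have hpn := Rat.num_div_eq_of_coprime hbpos hcop'
  have hpd := Rat.den_div_eq_of_coprime hbpos hcop'
  refine ⟨(a : ℚ) / b, by positivity, ?_, ?_⟩
  · rw [hpn, hpd]; exact hab
  · have : (((a : ℚ) / b).den : ℤ) < q.den := by rw [hpd]; exact hbv
    exact_mod_cast this

theorem fLN_coe_eq {p q : ℚ} (h0 : 0 < q) (h1 : q < 1) (hp0 : 0 ≤ p)
    (hdet : q.num * p.den - p.num * q.den = 1) (hden : p.den < q.den) :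
    fLN ((q : ℝ) : EReal) = ((p : ℝ) : EReal) := by
  have hpq : p < q := by rw [Rat.lt_iff]; linarith
  have hpn : 0 ≤ p.num := Rat.num_nonneg.2 hp0
  have hpd := num_lt_den_of_lt_one (hpq.trans h1)
  rw [fLN, flev_coe h0 h1]
  refine IsGreatest.csSup_eq ⟨⟨Or.inr ⟨p, rfl, by omega, by omega⟩, by exact_mod_cast hpq⟩, ?_⟩
  rintro r ⟨hr | ⟨c, rfl, -, hc⟩, hrq⟩
  · rcases hr with rfl | rfl | rfl
    · exact bot_le
    · simp at hrq
    · exact_mod_cast hp0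
  · have hcq : c < q := by exact_mod_cast hrq
    have hcp : c ≤ p := by
      by_contra! hpc
      rw [Rat.lt_iff] at hpc hcq
      have hc' : (c.den : ℤ) ≤ q.den := by exact_mod_cast hc
      have hpd0 : (0 : ℤ) < p.den := by exact_mod_cast p.den_pos
      have hqd0 : (0 : ℤ) < q.den := by exact_mod_cast q.den_pos
      have hsplit : (c.den : ℤ) = p.den * (q.num * c.den - c.num * q.den)
          + q.den * (c.num * p.den - p.num * c.den) := by
        linear_combination -(c.den : ℤ) * hdet
      have e1 : (p.den : ℤ) * 1 ≤ p.den * (q.num * c.den - c.num * q.den) :=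
        mul_le_mul_of_nonneg_left (by linarith) hpd0.le
      have e2 : (q.den : ℤ) * 1 ≤ q.den * (c.num * p.den - p.num * c.den) :=
        mul_le_mul_of_nonneg_left (by linarith) hqd0.le
      linarith
    exact_mod_cast hcp

theorem fLN_eq_bot_or_parent {q : ℚ} (h0 : 0 ≤ q) (h1 : q < 1) :
    (q = 0 ∧ fLN ((q : ℝ) : EReal) = ⊥) ∨
    ∃ p : ℚ, 0 ≤ p ∧ p < 1 ∧ fLN ((q : ℝ) : EReal) = ((p : ℝ) : EReal) ∧
      q.num * p.den - p.num * q.den = 1 ∧ p.den < q.den := by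
  rcases h0.eq_or_lt with rfl | hq
  · exact Or.inl ⟨rfl, by simpa using fLN_zero⟩
  · obtain ⟨p, hp0, hdet, hden⟩ := exists_left_parent hq h1
    have hpq : p < q := by rw [Rat.lt_iff]; linarith
    exact Or.inr ⟨p, hp0, hpq.trans h1, fLN_coe_eq hq h1 hp0 hdet hden, hdet, hden⟩

theorem exists_iterate_fLN_eq_bot {q : ℚ} (h0 : 0 ≤ q) (h1 : q < 1) :
    ∃ n : ℕ, fLN^[n] ((q : ℝ) : EReal) = ⊥ := by
  induction hd : q.den using Nat.strong_induction_on generalizing q with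
  | _ d ih =>
    rcases fLN_eq_bot_or_parent h0 h1 with ⟨-, h⟩ | ⟨p, hp0, hp1, hp, -, hden⟩
    · exact ⟨1, h⟩
    · obtain ⟨n, hn⟩ := ih p.den (hd ▸ hden) hp0 hp1 rfl
      exact ⟨n + 1, by rw [Function.iterate_succ_apply, hp, hn]⟩

theorem iterate_fL_eq_bot {q : ℚ} (h0 : 0 ≤ q) (h1 : q < 1) :
    fLN^[fL ((q : ℝ) : EReal)] ((q : ℝ) : EReal) = ⊥ :=
  Nat.sInf_mem (s := {n | fLN^[n] ((q : ℝ) : EReal) = ⊥}) (exists_iterate_fLN_eq_bot h0 h1)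

theorem iterate_fLN_eq_coe {q : ℚ} (h0 : 0 ≤ q) (h1 : q < 1) {k : ℕ}
    (hk : k < fL ((q : ℝ) : EReal)) :
    ∃ p : ℚ, 0 ≤ p ∧ p < 1 ∧ fLN^[k] ((q : ℝ) : EReal) = ((p : ℝ) : EReal) := by
  induction k with
  | zero => exact ⟨q, h0, h1, rfl⟩
  | succ k ih =>
    obtain ⟨p, hp0, hp1, hp⟩ := ih (by omega)
    have hne : fLN^[k + 1] ((q : ℝ) : EReal) ≠ ⊥ := Nat.notMem_of_lt_sInf hk
    rw [Function.iterate_succ_apply', hp] at hne ⊢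
    rcases fLN_eq_bot_or_parent hp0 hp1 with ⟨-, h⟩ | ⟨r, hr0, hr1, hr, -, -⟩
    · exact absurd h hne
    · exact ⟨r, hr0, hr1, hr⟩

theorem enum_eden_fLN {p : ℚ} (h0 : 0 ≤ p) (h1 : p < 1) :
    enum (fLN ((p : ℝ) : EReal)) * eden ((p : ℝ) : EReal)
        - enum ((p : ℝ) : EReal) * eden (fLN ((p : ℝ) : EReal)) = -1 ∧
      eden (fLN ((p : ℝ) : EReal)) < eden ((p : ℝ) : EReal) := by
  rw [enum_coe, eden_coe]
  rcases fLN_eq_bot_or_parent h0 h1 with ⟨rfl, h⟩ | ⟨r, -, -, hr, hdet, hden⟩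
  · rw [h, enum_bot, eden_bot]; simp
  · rw [hr, enum_coe, eden_coe]
    exact ⟨by linarith, by exact_mod_cast hden⟩

/-- for rational `0 ≤ q < 1` with `LNS(q) = (y_0, …, y_L)`,
`y_0 = -∞`, `y_L = q`, writing `y_l = a_l / b_l` in lowest terms with `b_l ≥ 0`:
for all `l = 1, …, L` one has `a_{l-1} b_l - a_l b_{l-1} = -1`, and
`0 = b_0 < b_1 < … < b_L` (the reversed sequence is a minimal partition of `q`). -/
theorem stmt2 (q : ℚ) (h0 : 0 ≤ q) (h1 : q < 1) :
    yseq q 0 = ⊥ ∧ yseq q (fL ((q : ℝ) : EReal)) = ((q : ℝ) : EReal) ∧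
    ∀ l : ℕ, 1 ≤ l → l ≤ fL ((q : ℝ) : EReal) →
      (enum (yseq q (l - 1)) * eden (yseq q l)
          - enum (yseq q l) * eden (yseq q (l - 1)) = -1) ∧
      eden (yseq q (l - 1)) < eden (yseq q l) ∧
      (l = 1 → eden (yseq q (l - 1)) = 0) := by
  have hbot := iterate_fL_eq_bot h0 h1
  refine ⟨hbot, by simp [yseq], fun l hl hlL => ?_⟩
  obtain ⟨p, hp0, hp1, hp⟩ :=
    iterate_fLN_eq_coe h0 h1 (k := fL ((q : ℝ) : EReal) - l) (by omega)
  have hl1 : yseq q (l - 1) = fLN ((p : ℝ) : EReal) := by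
    rw [yseq, show fL ((q : ℝ) : EReal) - (l - 1) = fL ((q : ℝ) : EReal) - l + 1 by omega,
      Function.iterate_succ_apply', hp]
  have hl0 : yseq q l = ((p : ℝ) : EReal) := hp
  refine ⟨?_, ?_, ?_⟩
  · rw [hl1, hl0]; exact (enum_eden_fLN hp0 hp1).1
  · rw [hl1, hl0]; exact (enum_eden_fLN hp0 hp1).2
  · rintro rfl
    have h : yseq q 0 = ⊥ := hbot
    rw [h, eden_bot]

end
end

section
/- Let q be rational with 0 ≤ q < 1 and LNS(q) = (a_0/b_0, …, a_L/b_L) (fractions in lowest terms, b_l ≥ 0), and let M(q) = Σ_{l=1}^L m_l with m_l = [[b_l, −a_l], [b_{l−1}, −a_{l−1}]]. Then for every l = 1, …, L, the bottom row (c_l, d_l) = (b_{l−1}, −a_{l−1}) of m_l satisfies c_l ζ + d_l > 0 for all real ζ ≥ q. -/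
noncomputable section

open Complex MeasureTheory

lemma finite_fareySet (n : ℕ) : (fareySet n).Finite := by
  refine Set.Finite.union (by simp) ?_
  have hfin : (((Set.Icc (-(n : ℤ)) n) ×ˢ (Set.Iic n)).image
      fun p : ℤ × ℕ => ((((p.1 : ℚ) / (p.2 : ℚ) : ℚ) : ℝ) : EReal)).Finite :=
    ((Set.finite_Icc _ _).prod (Set.finite_Iic n)).image _
  refine hfin.subset ?_
  rintro x ⟨r, rfl, hnum, hden⟩
  refine ⟨(r.num, r.den), ⟨⟨by dsimp only; omega, by dsimp only; omega⟩, hden⟩, ?_⟩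
  simp only [Rat.num_div_den]

lemma bot_mem_fareySet (n : ℕ) : (⊥ : EReal) ∈ fareySet n := Or.inl (by simp)

lemma fLN_bot : fLN ⊥ = ⊥ := by simp [fLN]

lemma fLN_mem {x : EReal} (hx : x ≠ ⊥) : fLN x ∈ fareySet (flev x) ∧ fLN x < x :=
  Set.Nonempty.csSup_mem (s := {r : EReal | r ∈ fareySet (flev x) ∧ r < x})
    ⟨⊥, bot_mem_fareySet _, bot_lt_iff_ne_bot.2 hx⟩
    ((finite_fareySet _).subset fun _ h => h.1)

lemma fLN_le (x : EReal) : fLN x ≤ x := by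
  rcases eq_or_ne x ⊥ with rfl | hx
  · exact fLN_bot.le
  · exact (fLN_mem hx).2.le

lemma iterate_fLN_le (k : ℕ) (x : EReal) : fLN^[k] x ≤ x :=
  Function.iterate_le_id_of_le_id fLN_le k x

/-- The proper left neighbors of a rational number are `-∞` or smaller rational numbers. -/
lemma iterate_succ_fLN_eq_bot_or (k : ℕ) (q : ℚ) :
    fLN^[k + 1] ((q : ℝ) : EReal) = ⊥ ∨
      ∃ r : ℚ, fLN^[k + 1] ((q : ℝ) : EReal) = ((r : ℝ) : EReal) ∧ r < q := by
  rw [Function.iterate_succ_apply']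
  set x := fLN^[k] ((q : ℝ) : EReal) with hx
  rcases eq_or_ne x ⊥ with h | h
  · exact Or.inl (h ▸ fLN_bot)
  obtain ⟨hmem, hlt⟩ := fLN_mem h
  have hlt' : fLN x < ((q : ℝ) : EReal) := hlt.trans_le (iterate_fLN_le k _)
  have of_eq : ∀ r : ℚ, fLN x = ((r : ℝ) : EReal) →
      ∃ r : ℚ, fLN x = ((r : ℝ) : EReal) ∧ r < q := fun r hr =>
    ⟨r, hr, by rw [hr] at hlt'; exact_mod_cast hlt'⟩
  rcases hmem with (h | h | h) | ⟨r, hr, -, -⟩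
  · exact Or.inl h
  · rw [h] at hlt'
    exact absurd hlt' not_top_lt
  · exact Or.inr (of_eq 0 (by rw [h]; simp))
  · exact Or.inr (of_eq r hr)

lemma exists_ratCast_choose_eq (r : ℚ) (h : ∃ p : ℚ, ((r : ℝ) : EReal) = ((p : ℝ) : EReal)) :
    h.choose = r := by
  have := h.choose_spec
  exact_mod_cast this.symm

lemma enum_ratCast (r : ℚ) : enum ((r : ℝ) : EReal) = r.num := by
  have h : ∃ p : ℚ, ((r : ℝ) : EReal) = ((p : ℝ) : EReal) := ⟨r, rfl⟩
  rw [enum, if_neg (EReal.coe_ne_bot _), if_neg (EReal.coe_ne_top _), dif_pos h,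
    exists_ratCast_choose_eq r h]

lemma eden_ratCast (r : ℚ) : eden ((r : ℝ) : EReal) = r.den := by
  have h : ∃ p : ℚ, ((r : ℝ) : EReal) = ((p : ℝ) : EReal) := ⟨r, rfl⟩
  rw [eden, if_neg (EReal.coe_ne_bot _), if_neg (EReal.coe_ne_top _), dif_pos h,
    exists_ratCast_choose_eq r h]

/-- for rational `0 ≤ q < 1` and `M(q) = Σ_{l=1}^L m_l`, the bottom row
`(c_l, d_l) = (b_{l-1}, -a_{l-1})` of each `m_l` satisfies `c_l ζ + d_l > 0` for all
real `ζ ≥ q`. -/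
theorem stmt3 (q : ℚ) (h0 : 0 ≤ q) (h1 : q < 1)
    (l : ℕ) (hl1 : 1 ≤ l) (hlL : l ≤ fL ((q : ℝ) : EReal)) :
    ∀ ζ : ℝ, (q : ℝ) ≤ ζ →
      0 < (mMat q l 1 0 : ℝ) * ζ + (mMat q l 1 1 : ℝ) := by
  intro ζ hζ
  obtain ⟨k, hk⟩ : ∃ k, fL ((q : ℝ) : EReal) - (l - 1) = k + 1 :=
    ⟨fL ((q : ℝ) : EReal) - l, by omega⟩
  simp only [mMat, Matrix.of_apply, Matrix.cons_val', Matrix.cons_val_zero, Matrix.cons_val_one,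
    Matrix.cons_val_fin_one, yseq, hk]
  rcases iterate_succ_fLN_eq_bot_or k q with h | ⟨r, h, hrq⟩
  · simp [h, eden, enum]
  · rw [h, eden_ratCast, enum_ratCast]
    have hden : (0 : ℝ) < r.den := by exact_mod_cast r.den_pos
    have hrζ : (r : ℝ) < ζ := lt_of_lt_of_le (by exact_mod_cast hrq) hζ
    have hnum : (r : ℝ) * r.den = r.num := by exact_mod_cast Rat.mul_den_eq_num r
    push_cast
    nlinarith

end
end
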